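/- On the piece ℬ₁, F is linear: for every (x,y) ∈ ℬ₁, F(x,y) = B(x,y), where B is the linear map of ℝ² with matrix (1/(t−s))·[[t² − (1−s)², (1−2s)t], [(2s−1)t, (2t−1)t]]. Moreover det B = 1, B(E₁) = E₁, B(P₁) = P₁′ and B(P₄) = P₄′. -/

import Mathlib

open Real Set Filter

noncomputable section

/-- A point in the plane. -/
abbrev Pt : Type := ℝ × ℝ

/-- The unit square `Q = [0,1] × [0,1]`. -/
def unitSq : Set Pt := Icc (0:ℝ) 1 ×ˢ Icc (0:ℝ) 1

/-- The corners `E₁, E₂, E₃, E₄` of the unit square (cyclically indexed). -/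
def Ept : Fin 4 → Pt := ![(0,0), (1,0), (1,1), (0,1)]

/-- The inner points `P₁, P₂, P₃, P₄` (cyclically indexed). -/
def Ppt (s t : ℝ) : Fin 4 → Pt := ![(s,t), (1-t,s), (1-s,1-t), (t,1-s)]

/-- The image points `P₁′, P₂′, P₃′, P₄′` (cyclically indexed). -/
def Ppt' (s t : ℝ) : Fin 4 → Pt := ![(1-s,t), (1-t,1-s), (s,1-t), (t,s)]

/-- The triangle `𝒜ᵢ = conv {Eᵢ, Eᵢ₊₁, Pᵢ}`. -/
def Apiece (s t : ℝ) (i : Fin 4) : Set Pt :=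
  convexHull ℝ {Ept i, Ept (i+1), Ppt s t i}

/-- The triangle `ℬᵢ = conv {Eᵢ, Pᵢ, Pᵢ₋₁}`. -/
def Bpiece (s t : ℝ) (i : Fin 4) : Set Pt :=
  convexHull ℝ {Ept i, Ppt s t i, Ppt s t (i-1)}

/-- The central square `𝒞 = conv {P₁, P₂, P₃, P₄}`. -/
def Cpiece (s t : ℝ) : Set Pt :=
  convexHull ℝ {Ppt s t 0, Ppt s t 1, Ppt s t 2, Ppt s t 3}

/-- `F : Q → Q` is continuous, affine on each of the nine pieces, fixes the
corners `Eᵢ` and maps `Pᵢ` to `Pᵢ′`. -/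
def IsPAMap (s t : ℝ) (F : Pt → Pt) : Prop :=
  MapsTo F unitSq unitSq ∧
  ContinuousOn F unitSq ∧
  (∀ i : Fin 4, ∃ g : Pt →ᵃ[ℝ] Pt, EqOn F g (Apiece s t i)) ∧
  (∀ i : Fin 4, ∃ g : Pt →ᵃ[ℝ] Pt, EqOn F g (Bpiece s t i)) ∧
  (∃ g : Pt →ᵃ[ℝ] Pt, EqOn F g (Cpiece s t)) ∧
  (∀ i : Fin 4, F (Ept i) = Ept i) ∧
  (∀ i : Fin 4, F (Ppt s t i) = Ppt' s t i)

/-- The linear map `B` with matrix `(1/(t-s)) ⬝ [[t² - (1-s)², (1-2s)t], [(2s-1)t, (2t-1)t]]`. -/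
def Bmap (s t : ℝ) : Pt → Pt := fun p =>
  ((1/(t-s)) * ((t^2 - (1-s)^2) * p.1 + (1-2*s)*t * p.2),
   (1/(t-s)) * ((2*s-1)*t * p.1 + (2*t-1)*t * p.2))

/-- Two affine maps which agree on a set agree on its convex hull. -/
theorem AffineMap.eqOn_convexHull {E E' : Type*} [AddCommGroup E] [Module ℝ E]
    [AddCommGroup E'] [Module ℝ E'] {f g : E →ᵃ[ℝ] E'} {S : Set E} (h : EqOn f g S) :
    EqOn f g (convexHull ℝ S) := by
  have hconv : Convex ℝ {p | f p = g p} := by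
    intro x hx y hy a b _ _ hab
    simp only [mem_ofPred_eq] at hx hy ⊢
    rw [Convex.combo_affine_apply hab, Convex.combo_affine_apply hab, hx, hy]
  exact convexHull_min h hconv

theorem isLinearMap_Bmap (s t : ℝ) : IsLinearMap ℝ (Bmap s t) where
  map_add x y := by ext <;> simp only [Bmap, Prod.fst_add, Prod.snd_add] <;> ring
  map_smul c x := by
    ext <;> simp only [Bmap, Prod.smul_fst, Prod.smul_snd, smul_eq_mul] <;> ring

theorem Bmap_Ept_zero (s t : ℝ) : Bmap s t (Ept 0) = Ept 0 := by
  simp [Bmap, Ept]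

theorem Bmap_Ppt_zero {s t : ℝ} (hst : s ^ 2 = t - t ^ 2) (hne : t - s ≠ 0) :
    Bmap s t (Ppt s t 0) = Ppt' s t 0 := by
  ext
  · simp only [Bmap, Ppt, Ppt', Matrix.cons_val]
    field_simp
    linear_combination (1 - s) * hst
  · simp only [Bmap, Ppt, Ppt', Matrix.cons_val]
    field_simp
    linear_combination 2 * t * hst

theorem Bmap_Ppt_three {s t : ℝ} (hst : s ^ 2 = t - t ^ 2) (hne : t - s ≠ 0) :
    Bmap s t (Ppt s t 3) = Ppt' s t 3 := by
  ext
  · simp only [Bmap, Ppt, Ppt', Matrix.cons_val]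
    field_simp
    linear_combination t * hst
  · simp only [Bmap, Ppt, Ppt', Matrix.cons_val]
    field_simp
    linear_combination hst

theorem det_Bmap_matrix {s t : ℝ} (hst : s ^ 2 = t - t ^ 2) (hne : t - s ≠ 0) :
    Matrix.det !![(t^2 - (1-s)^2)/(t-s), (1-2*s)*t/(t-s);
                  (2*s-1)*t/(t-s), (2*t-1)*t/(t-s)] = 1 := by
  rw [Matrix.det_fin_two_of]
  field_simp
  linear_combination (2 * t ^ 2 + t - 1) * hst

theorem sin_sq_lt_sin_mul_cos {θ : ℝ} (hθ : θ ∈ Ioo 0 (π / 4)) :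
    sin θ ^ 2 < sin θ * cos θ := by
  obtain ⟨h0, h1⟩ := hθ
  have hsin : 0 < sin θ := sin_pos_of_pos_of_lt_pi h0 (by linarith [pi_pos])
  have hlt : sin θ < cos θ := by
    rw [← sin_pi_div_two_sub]
    exact sin_lt_sin_of_lt_of_le_pi_div_two (by linarith) (by linarith) (by linarith)
  rw [sq]
  exact mul_lt_mul_of_pos_left hlt hsin

/-- On the piece `ℬ₁`, `F` is the linear map `B`; moreover `B` is
linear, has determinant `1`, fixes `E₁` and maps `P₁ ↦ P₁′`, `P₄ ↦ P₄′`. -/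
theorem square_map_linear_on_B1 (θ : ℝ) (hθ : θ ∈ Ioo 0 (π/4))
    (t s : ℝ) (ht : t = sin θ ^ 2) (hs : s = sin θ * cos θ)
    (F : Pt → Pt) (hF : IsPAMap s t F) :
    (∀ p ∈ Bpiece s t 0, F p = Bmap s t p) ∧
    IsLinearMap ℝ (Bmap s t) ∧
    Matrix.det !![(t^2 - (1-s)^2)/(t-s), (1-2*s)*t/(t-s);
                  (2*s-1)*t/(t-s), (2*t-1)*t/(t-s)] = 1 ∧
    Bmap s t (Ept 0) = Ept 0 ∧
    Bmap s t (Ppt s t 0) = Ppt' s t 0 ∧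
    Bmap s t (Ppt s t 3) = Ppt' s t 3 := by
  have hst : s ^ 2 = t - t ^ 2 := by
    rw [hs, ht]
    linear_combination sin θ ^ 2 * sin_sq_add_cos_sq θ
  have hne : t - s ≠ 0 := by
    rw [hs, ht]
    exact (sub_neg.2 (sin_sq_lt_sin_mul_cos hθ)).ne
  have hP₁ := Bmap_Ppt_zero hst hne
  have hP₄ := Bmap_Ppt_three hst hne
  refine ⟨?_, isLinearMap_Bmap s t, det_Bmap_matrix hst hne, Bmap_Ept_zero s t, hP₁, hP₄⟩
  obtain ⟨-, -, -, hB, -, hE, hP⟩ := hF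
  obtain ⟨g, hg⟩ := hB 0
  have hvert : EqOn g ((isLinearMap_Bmap s t).mk' _).toAffineMap
      {Ept 0, Ppt s t 0, Ppt s t (0 - 1)} := by
    intro p hp
    rw [← hg (subset_convexHull ℝ _ hp)]
    change F p = Bmap s t p
    rcases hp with rfl | rfl | rfl
    · rw [hE, Bmap_Ept_zero]
    · rw [hP, hP₁]
    · rw [hP]
      exact hP₄.symm
  intro p hp
  rw [hg hp]
  exact AffineMap.eqOn_convexHull hvert hp
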